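/- arXiv:2206.01152 — 2 statements merged into one kernel-verified Lean document; each statement's English description precedes it below -/
import Mathlib

section
/- If G is a DAG on Fin p, i → j is a covered edge of G, and G' is obtained from G by reversing this edge to j → i (keeping all other edges), then G' is a DAG and G and G' are Markov equivalent. -/
namespace CausalDiscovery

variable {V : Type*}

/-- A relation is acyclic if it has no directed cycles. -/
def Acyclic (E : V → V → Prop) : Prop :=
  ∀ v, ¬ Relation.TransGen E v v

/-- `i` and `j` are adjacent (joined by an edge in either direction). -/
def Adj (E : V → V → Prop) (i j : V) : Prop :=
  E i j ∨ E j i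

/-- `j` is a descendant of `i`, i.e. reachable from `i` by a directed path. -/
def Desc (E : V → V → Prop) (i j : V) : Prop :=
  Relation.ReflTransGen E i j

/-- `f 0, f 1, …, f n` is a path between `i` and `j`: the vertices are distinct and
consecutive vertices are adjacent. -/
def IsPath (E : V → V → Prop) (n : ℕ) (f : ℕ → V) (i j : V) : Prop :=
  0 < n ∧ f 0 = i ∧ f n = j ∧
    (∀ s t, s ≤ n → t ≤ n → f s = f t → s = t) ∧
    ∀ t, t < n → Adj E (f t) (f (t + 1))

/-- The vertex at (interior) position `t` of the path `f` is a collider: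
both edges of the path at that vertex point into it. -/
def ColliderAt (E : V → V → Prop) (f : ℕ → V) (t : ℕ) : Prop :=
  E (f (t - 1)) (f t) ∧ E (f (t + 1)) (f t)

/-- The path `f 0, …, f n` d-connects its endpoints given `C`: every non-collider
interior vertex is outside `C`, every collider is in `C` or has a descendant in `C`. -/
def DConn (E : V → V → Prop) (n : ℕ) (f : ℕ → V) (C : Finset V) : Prop :=
  ∀ t, 0 < t → t < n →
    (ColliderAt E f t → f t ∈ C ∨ ∃ d ∈ C, Desc E (f t) d) ∧
    (¬ ColliderAt E f t → f t ∉ C)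

/-- `i` and `j` are d-separated given `C`: no path between them d-connects given `C`. -/
def DSep (E : V → V → Prop) (i j : V) (C : Finset V) : Prop :=
  ∀ n f, IsPath E n f i j → ¬ DConn E n f C

/-- The independence model `I(E)`: all d-separation triples `(i, j, C)` with `i, j`
distinct and `C ⊆ V \ {i, j}`. -/
def Indep (E : V → V → Prop) : Set (V × V × Finset V) :=
  {x | x.1 ≠ x.2.1 ∧ x.1 ∉ x.2.2 ∧ x.2.1 ∉ x.2.2 ∧ DSep E x.1 x.2.1 x.2.2}

/-- Two graphs are Markov equivalent if they have the same independence model. -/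
def MarkovEquiv (E E' : V → V → Prop) : Prop :=
  Indep E = Indep E'

/-- Two graphs have the same skeleton if they have the same adjacencies. -/
def SameSkeleton (E E' : V → V → Prop) : Prop :=
  ∀ i j, Adj E i j ↔ Adj E' i j

/-- The v-structures of a graph: triples `(i, j, k)` with `i → j ← k` and `i, k`
not adjacent. -/
def VStruct (E : V → V → Prop) : Set (V × V × V) :=
  {x | E x.1 x.2.1 ∧ E x.2.2 x.2.1 ∧ x.1 ≠ x.2.2 ∧ ¬ Adj E x.1 x.2.2}


/-- The edge `i → j` is a covered edge: `pa(i) = pa(j) \ {i}`. -/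
def Covered (E : V → V → Prop) (i j : V) : Prop :=
  E i j ∧ ∀ k, E k i ↔ E k j ∧ k ≠ i

/-- The graph obtained by reversing the edge `i → j` to `j → i`, keeping all
other edges. -/
def ReverseEdge (E : V → V → Prop) (i j : V) : V → V → Prop :=
  fun a b => (E a b ∧ ¬(a = i ∧ b = j)) ∨ (a = j ∧ b = i)

theorem Acyclic.asymm {E : V → V → Prop} (hE : Acyclic E) {a b : V} (h : E a b) : ¬ E b a :=
  fun h' => hE a (.tail (.single h) h')

theorem Acyclic.irrefl {E : V → V → Prop} (hE : Acyclic E) (a : V) : ¬ E a a :=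
  fun h => hE a (.single h)

/-- The consecutive vertices `u, v, w` of a walk do not block it at `v` given `C`. -/
def Unblocked (E : V → V → Prop) (C : Finset V) (u v w : V) : Prop :=
  (E u v ∧ E w v → ∃ d ∈ C, Desc E v d) ∧ (¬ (E u v ∧ E w v) → v ∉ C)

theorem dConn_iff_unblocked {E : V → V → Prop} {n : ℕ} {f : ℕ → V} {C : Finset V} :
    DConn E n f C ↔ ∀ t, 0 < t → t < n → Unblocked E C (f (t - 1)) (f t) (f (t + 1)) := by
  refine forall_congr' fun t => forall_congr' fun _ => forall_congr' fun _ => ?_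
  refine and_congr (imp_congr_right fun _ => ⟨?_, Or.inr⟩) Iff.rfl
  rintro (h | h)
  · exact ⟨_, h, .refl⟩
  · exact h

theorem Unblocked.symm {E : V → V → Prop} {C : Finset V} {u v w : V}
    (h : Unblocked E C u v w) : Unblocked E C w v u :=
  ⟨fun hc => h.1 hc.symm, fun hc => h.2 fun h' => hc h'.symm⟩

/-- `f 0, …, f n` is a walk from `x` to `y`, possibly with repeated vertices, which d-connects
its endpoints given `C`. -/
structure DWalk (E : V → V → Prop) (C : Finset V) (n : ℕ) (f : ℕ → V) (x y : V) : Prop where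
  source : f 0 = x
  target : f n = y
  adj : ∀ t, t < n → Adj E (f t) (f (t + 1))
  unblocked : ∀ t, 0 < t → t < n → Unblocked E C (f (t - 1)) (f t) (f (t + 1))

theorem DWalk.reverse {E : V → V → Prop} {C : Finset V} {n : ℕ} {f : ℕ → V} {x y : V}
    (h : DWalk E C n f x y) : DWalk E C n (fun t => f (n - t)) y x where
  source := by simpa using h.target
  target := by simpa using h.source
  adj t ht := by
    have := h.adj (n - (t + 1)) (by omega)
    rw [show n - (t + 1) + 1 = n - t by omega] at this
    exact this.symm
  unblocked t h0 ht := by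
    have := h.unblocked (n - t) (by omega) (by omega)
    rw [show n - t - 1 = n - (t + 1) by omega, show n - t + 1 = n - (t - 1) by omega] at this
    exact this.symm

/-- A stretch of a walk that leaves its first vertex along a forward edge and enters its last
vertex along a backward edge contains a collider that descends from the first vertex. -/
theorem exists_collider_desc {E : V → V → Prop} (hE : Acyclic E) {f : ℕ → V} {r : ℕ}
    (hr : E (f r) (f (r - 1))) (k : ℕ) :
    ∀ s, s + k = r → (∀ t, s ≤ t → t < r → Adj E (f t) (f (t + 1))) → 0 < k →
      E (f s) (f (s + 1)) →
      ∃ c, s < c ∧ c < r ∧ ColliderAt E f c ∧ Desc E (f s) (f c) := by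
  induction k with
  | zero => intro s _ _ h; omega
  | succ k ih =>
    intro s hs hadj _ he
    rcases Nat.eq_zero_or_pos k with rfl | hk
    · subst hs
      exact absurd hr (hE.asymm he)
    · rcases hadj (s + 1) (by omega) (by omega) with h | h
      · obtain ⟨c, h1, h2, h3, h4⟩ :=
          ih (s + 1) (by omega) (fun t ht => hadj t (by omega)) hk h
        exact ⟨c, by omega, h2, h3, .head he h4⟩
      · exact ⟨s + 1, by omega, by omega, ⟨he, h⟩, .single he⟩

/-- A closed stretch of a d-connecting walk at an interior vertex can be cut out without blocking
the walk there. -/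
theorem DWalk.unblocked_of_eq {E : V → V → Prop} (hE : Acyclic E) {C : Finset V} {n : ℕ}
    {f : ℕ → V} {x y : V} (h : DWalk E C n f x y) {s r : ℕ} (hs : 0 < s) (hsr : s < r)
    (hr : r < n) (hf : f s = f r) : Unblocked E C (f (s - 1)) (f s) (f (r + 1)) := by
  have us := h.unblocked s hs (by omega)
  have ur := h.unblocked r (by omega) hr
  refine ⟨fun ⟨h1, h2⟩ => ?_, fun hc hC => ?_⟩
  · by_cases h3 : E (f (s + 1)) (f s)
    · exact us.1 ⟨h1, h3⟩
    by_cases h4 : E (f (r - 1)) (f r)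
    · rw [hf] at h2 ⊢
      exact ur.1 ⟨h4, h2⟩
    have h5 := (h.adj s (by omega)).resolve_right h3
    have h6 := h.adj (r - 1) (by omega)
    rw [Nat.sub_add_cancel (by omega)] at h6
    obtain ⟨c, hc1, hc2, hc3, hc4⟩ := exists_collider_desc hE (h6.resolve_left h4) (r - s) s
      (by omega) (fun t _ ht => h.adj t (by omega)) (by omega) h5
    obtain ⟨d, hd, hcd⟩ := (h.unblocked c (by omega) (by omega)).1 hc3
    exact ⟨d, hd, hc4.trans hcd⟩
  · have h1 : E (f (s - 1)) (f s) := by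
      by_contra h1
      exact us.2 (fun h' => h1 h'.1) hC
    have h2 : E (f (r + 1)) (f r) := by
      by_contra h2
      exact ur.2 (fun h' => h2 h'.2) (hf ▸ hC)
    exact hc ⟨h1, hf ▸ h2⟩

/-- The sequence obtained from `f` by leaving out the `d` terms after position `a`. -/
def splice (f : ℕ → V) (a d t : ℕ) : V :=
  if t ≤ a then f t else f (t + d)

theorem DWalk.splice {E : V → V → Prop} (hE : Acyclic E) {C : Finset V} {n : ℕ}
    {f : ℕ → V} {x y : V} (h : DWalk E C n f x y) {s r : ℕ} (hsr : s < r)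
    (hr : r ≤ n) (hf : f s = f r) :
    DWalk E C (n - (r - s)) (splice f s (r - s)) x y where
  source := by simp [CausalDiscovery.splice, h.source]
  target := by
    rw [← h.target]
    unfold CausalDiscovery.splice
    split_ifs
    · rw [show n - (r - s) = s by omega, hf, show r = n by omega]
    · congr 1; omega
  adj t ht := by
    rcases lt_trichotomy t s with hts | rfl | hts
    · have := h.adj t (by omega)
      grind [CausalDiscovery.splice]
    · have := h.adj r (by omega)
      grind [CausalDiscovery.splice]
    · have := h.adj (t + (r - s)) (by omega)
      grind [CausalDiscovery.splice]
  unblocked t h0 ht := by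
    rcases lt_trichotomy t s with hts | rfl | hts
    · have := h.unblocked t h0 (by omega)
      grind [CausalDiscovery.splice]
    · have := h.unblocked_of_eq hE h0 hsr (by omega) hf
      grind [CausalDiscovery.splice]
    · have := h.unblocked (t + (r - s)) (by omega) (by omega)
      grind [CausalDiscovery.splice]

/-- The endpoints of a d-connecting walk are joined by a d-connecting path. -/
theorem DWalk.exists_path {E : V → V → Prop} (hE : Acyclic E) {C : Finset V} {x y : V}
    (hxy : x ≠ y) (h : ∃ n f, DWalk E C n f x y) :
    ∃ n f, IsPath E n f x y ∧ DConn E n f C := by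
  classical
  obtain ⟨f, hf⟩ := Nat.find_spec h
  have hinj : ∀ s r, s < r → r ≤ Nat.find h → f s ≠ f r := fun s r hsr hr heq =>
    Nat.find_min h (by omega) ⟨_, hf.splice hE hsr hr heq⟩
  refine ⟨_, f, ⟨Nat.pos_of_ne_zero fun h0 => hxy ?_, hf.source, hf.target, ?_, hf.adj⟩,
    dConn_iff_unblocked.2 hf.unblocked⟩
  · rw [← hf.source, ← hf.target, h0]
  · intro s t hs ht heq
    rcases lt_trichotomy s t with h' | h' | h'
    · exact absurd heq (hinj s t h' ht)
    · exact h'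
    · exact absurd heq.symm (hinj t s h' hs)

section Reversal

variable {G : V → V → Prop} {i j : V}

theorem reverseEdge_acyclic (hG : Acyclic G) (hcov : Covered G i j) :
    Acyclic (ReverseEdge G i j) := by
  have key : ∀ x y, x ≠ j → Relation.TransGen (ReverseEdge G i j) x y →
      Relation.TransGen G x y ∧ (y = j → Relation.TransGen G x i) := by
    intro x y hx h
    induction h with
    | single h =>
      rcases h with ⟨h, hn⟩ | ⟨h, -⟩
      · refine ⟨.single h, ?_⟩
        rintro rfl
        exact .single ((hcov.2 x).2 ⟨h, fun h' => hn ⟨h', rfl⟩⟩)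
      · exact absurd h hx
    | @tail y z _ h ih =>
      rcases h with ⟨h, hn⟩ | ⟨h1, rfl⟩
      · refine ⟨ih.1.tail h, ?_⟩
        rintro rfl
        exact ih.1.tail ((hcov.2 y).2 ⟨h, fun h' => hn ⟨h', rfl⟩⟩)
      · exact ⟨ih.2 h1, fun _ => ih.2 h1⟩
  intro v hv
  by_cases hvj : v = j
  · subst hvj
    obtain ⟨w, hw, hwv⟩ := Relation.TransGen.head'_iff.1 hv
    have hne : w ≠ v := by
      rintro rfl
      rcases hw with ⟨h, -⟩ | ⟨-, h⟩
      · exact hG.irrefl _ h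
      · exact hG.irrefl w (by simpa [← h] using hcov.1)
    exact hG w (key w w hne (Relation.TransGen.tail' hwv hw)).1
  · exact hG v (key v v hvj hv).1

theorem covered_reverseEdge (hG : Acyclic G) (hcov : Covered G i j) :
    Covered (ReverseEdge G i j) j i := by
  have h1 := hG.irrefl i
  have h2 := hG.irrefl j
  have h3 := hG.asymm hcov.1
  have h4 := hcov.1
  refine ⟨.inr ⟨rfl, rfl⟩, fun k => ?_⟩
  have := hcov.2 k
  unfold ReverseEdge
  grind

theorem reverseEdge_reverseEdge (hG : Acyclic G) (hcov : Covered G i j) :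
    ReverseEdge (ReverseEdge G i j) j i = G := by
  have h3 := hG.asymm hcov.1
  have h4 := hcov.1
  funext a b
  unfold ReverseEdge
  grind

theorem reverseEdge_adj {a b : V} (h : Adj G a b) : Adj (ReverseEdge G i j) a b := by
  unfold Adj ReverseEdge at *
  grind

theorem reverseEdge_desc_of_ne (hcov : Covered G i j) {x y : V} (hx : x ≠ i)
    (h : Desc G x y) : Desc (ReverseEdge G i j) x y := by
  suffices Desc (ReverseEdge G i j) x y ∧ (y = i → Desc (ReverseEdge G i j) x j) from this.1
  induction h with
  | refl => exact ⟨.refl, fun h => absurd h hx⟩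
  | @tail y z _ h ih =>
    by_cases hyz : y = i ∧ z = j
    · obtain ⟨rfl, rfl⟩ := hyz
      exact ⟨ih.2 rfl, fun _ => ih.2 rfl⟩
    · refine ⟨ih.1.tail (.inl ⟨h, hyz⟩), ?_⟩
      rintro rfl
      obtain ⟨h1, h2⟩ := (hcov.2 y).1 h
      exact ih.1.tail (.inl ⟨h1, fun h' => h2 h'.1⟩)

theorem reverseEdge_desc_source (hG : Acyclic G) (hcov : Covered G i j) {y : V}
    (h : Desc G i y) : Desc (ReverseEdge G i j) i y ∨ Desc (ReverseEdge G i j) j y := by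
  rcases Relation.ReflTransGen.cases_head h with rfl | ⟨w, hw, hwy⟩
  · exact .inl .refl
  · have hwi : w ≠ i := by
      rintro rfl
      exact hG.irrefl _ hw
    have := reverseEdge_desc_of_ne hcov hwi hwy
    by_cases hwj : w = j
    · exact .inr (hwj ▸ this)
    · exact .inl (.head (.inl ⟨hw, fun h' => hwj h'.2⟩) this)

theorem Unblocked.reverseEdge (hcov : Covered G i j) {C : Finset V} {u v w : V}
    (h : Unblocked G C u v w) (hv : v ≠ i) (hu : ¬ (u = i ∧ v = j)) (hw : ¬ (w = i ∧ v = j)) :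
    Unblocked (ReverseEdge G i j) C u v w := by
  have hiff : (ReverseEdge G i j u v ∧ ReverseEdge G i j w v) ↔ (G u v ∧ G w v) := by
    unfold ReverseEdge
    grind
  unfold Unblocked
  rw [hiff]
  refine ⟨fun hc => ?_, h.2⟩
  obtain ⟨d, hd, hvd⟩ := h.1 hc
  exact ⟨d, hd, reverseEdge_desc_of_ne hcov hv hvd⟩

theorem Unblocked.of_not_collider {C : Finset V} {u v w : V} (hc : ¬ (G u v ∧ G w v))
    (hv : v ∉ C) : Unblocked G C u v w :=
  ⟨fun h => absurd h hc, fun _ => hv⟩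

theorem IsPath.dWalk {C : Finset V} {n : ℕ} {f : ℕ → V} {x y : V} (hp : IsPath G n f x y)
    (hd : DConn G n f C) : DWalk G C n f x y :=
  ⟨hp.2.1, hp.2.2.1, hp.2.2.2.2, dConn_iff_unblocked.1 hd⟩

theorem exists_dWalk_reverseEdge_of_consecutive (hG : Acyclic G) (hcov : Covered G i j)
    {C : Finset V} {n : ℕ} {f : ℕ → V} {x y : V} (h : DWalk G C n f x y)
    (hinj : ∀ s t, s ≤ n → t ≤ n → f s = f t → s = t) {t : ℕ} (ht : t < n)
    (hti : f t = i) (htj : f (t + 1) = j) :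
    ∃ n f, DWalk (ReverseEdge G i j) C n f x y := by
  have hi : ∀ s, s ≤ n → f s = i → s = t := fun s hs h' => hinj s t hs ht.le (h'.trans hti.symm)
  have hj : ∀ s, s ≤ n → f s = j → s = t + 1 := fun s hs h' => hinj s _ hs ht (h'.trans htj.symm)
  have hij : G i j := hcov.1
  have hji : ¬ G j i := hG.asymm hij
  have hne : i ≠ j := by
    rintro rfl
    exact hji hij
  have hadj : ∀ s, s < n → Adj (ReverseEdge G i j) (f s) (f (s + 1)) :=
    fun s hs => reverseEdge_adj (h.adj s hs)
  have hfar : ∀ s, 0 < s → s < n → s ≠ t → s ≠ t + 1 →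
      Unblocked (ReverseEdge G i j) C (f (s - 1)) (f s) (f (s + 1)) := fun s h0 hs h1 h2 =>
    (h.unblocked s h0 hs).reverseEdge hcov (fun h' => h1 (hi s hs.le h'))
      (fun h' => h2 (hj s hs.le h'.2)) (fun h' => h2 (hj s hs.le h'.2))
  have hiC : 0 < t → i ∉ C := fun h0 => by
    have := (h.unblocked t h0 ht).2
    rw [hti, htj] at this
    exact this fun h' => hji h'.2
  by_cases ha : 0 < t ∧ G (f (t - 1)) i
  · obtain ⟨h0, ha⟩ := ha
    obtain ⟨haj, hai⟩ := (hcov.2 _).1 ha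
    have haj' : ReverseEdge G i j (f (t - 1)) j := .inl ⟨haj, fun h' => hai h'.1⟩
    have hja' : ¬ ReverseEdge G i j j (f (t - 1)) :=
      (reverseEdge_acyclic hG hcov).asymm haj'
    refine ⟨n - 1, splice f (t - 1) 1, ?_, ?_, ?_, ?_⟩
    · simp [splice, h.source]
    · rw [← h.target]
      grind [splice]
    · intro s hs
      rcases lt_trichotomy s (t - 1) with h1 | h1 | h1
      · have := hadj s (by omega)
        grind [splice]
      · have : Adj (ReverseEdge G i j) (f (t - 1)) j := .inl haj'
        grind [splice]
      · have := hadj (s + 1) (by omega)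
        grind [splice]
    · intro s hs0 hs
      rcases lt_trichotomy s (t - 1) with h1 | h1 | h1
      · have := hfar s hs0 (by omega) (by omega) (by omega)
        grind [splice]
      · have haC : f (t - 1) ∉ C := by
          have := (h.unblocked (t - 1) (by omega) (by omega)).2
          rw [Nat.sub_add_cancel (by omega), hti] at this
          exact this fun h' => hG.asymm ha h'.2
        have : Unblocked (ReverseEdge G i j) C (f (t - 1 - 1)) (f (t - 1)) j :=
          .of_not_collider (fun h' => hja' h'.2) haC
        grind [splice]
      · rcases (show t ≤ s by omega).eq_or_lt with rfl | h2
        · have hb : f (t + 1 + 1) ≠ i := fun h' => by have := hi _ (by omega) h'; omega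
          have h3 := h.unblocked (t + 1) (by omega) (by omega)
          rw [Nat.add_sub_cancel, hti, htj] at h3
          have h4 : Unblocked G C (f (t - 1)) j (f (t + 1 + 1)) :=
            ⟨fun h' => h3.1 ⟨hij, h'.2⟩, fun h' => h3.2 fun h'' => h' ⟨haj, h''.2⟩⟩
          have := h4.reverseEdge hcov hne.symm (fun h' => hai h'.1) (fun h' => hb h'.1)
          grind [splice]
        · have := hfar (s + 1) (by omega) (by omega) (by omega) (by omega)
          grind [splice]
  · have hia : 0 < t → G i (f (t - 1)) := fun h0 => by
      have := h.adj (t - 1) (by omega)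
      rw [Nat.sub_add_cancel h0, hti] at this
      exact this.resolve_left fun h' => ha ⟨h0, h'⟩
    have hai' : 0 < t → ¬ ReverseEdge G i j (f (t - 1)) i := fun h0 h' => by
      rcases h' with ⟨h', -⟩ | ⟨h', -⟩
      · exact ha ⟨h0, h'⟩
      · have := hj _ (by omega) h'
        omega
    by_cases hb : t + 1 < n ∧ G (f (t + 1 + 1)) j
    · obtain ⟨hn, hb⟩ := hb
      have hbi : G (f (t + 1 + 1)) i :=
        (hcov.2 _).2 ⟨hb, fun h' => by have := hi _ (by omega) h'; omega⟩
      have hbi' : ReverseEdge G i j (f (t + 1 + 1)) i := .inl ⟨hbi, fun h' => hne h'.2⟩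
      refine ⟨n - 1, splice f t 1, ?_, ?_, ?_, ?_⟩
      · simp [splice, h.source]
      · rw [← h.target]
        grind [splice]
      · intro s hs
        rcases lt_trichotomy s t with h1 | h1 | h1
        · have := hadj s (by omega)
          grind [splice]
        · have : Adj (ReverseEdge G i j) i (f (t + 1 + 1)) := .inr hbi'
          grind [splice]
        · have := hadj (s + 1) (by omega)
          grind [splice]
      · intro s hs0 hs
        rcases lt_trichotomy s t with h1 | rfl | h1
        · have := hfar s hs0 (by omega) (by omega) (by omega)
          grind [splice]
        · have : Unblocked (ReverseEdge G i j) C (f (s - 1)) i (f (s + 1 + 1)) :=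
            .of_not_collider (fun h' => hai' hs0 h'.1) (hiC hs0)
          grind [splice]
        · rcases (show t + 1 ≤ s by omega).eq_or_lt with rfl | h2
          · have hbC : f (t + 1 + 1) ∉ C := by
              have := (h.unblocked (t + 1 + 1) (by omega) (by omega)).2
              rw [Nat.add_sub_cancel, htj] at this
              exact this fun h' => hG.asymm hb h'.1
            have : Unblocked (ReverseEdge G i j) C i (f (t + 1 + 1)) (f (t + 1 + 1 + 1)) :=
              .of_not_collider
                (fun h' => (reverseEdge_acyclic hG hcov).asymm hbi' h'.1) hbC
            grind [splice]
          · have := hfar (s + 1) (by omega) (by omega) (by omega) (by omega)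
            grind [splice]
    · refine ⟨n, f, h.source, h.target, hadj, fun s hs0 hs => ?_⟩
      by_cases h1 : s = t
      · subst h1
        rw [hti]
        exact .of_not_collider (fun h' => hai' hs0 h'.1) (hiC hs0)
      by_cases h2 : s = t + 1
      · subst h2
        have hbj : ¬ G (f (t + 1 + 1)) j := fun h' => hb ⟨hs, h'⟩
        have hjC := (h.unblocked (t + 1) hs0 hs).2
        rw [htj] at hjC ⊢
        refine .of_not_collider (fun h' => ?_) (hjC fun h' => hbj h'.2)
        rcases h'.2 with ⟨h', -⟩ | ⟨-, h'⟩
        · exact hbj h'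
        · exact hne h'.symm
      · exact hfar s hs0 hs h1 h2

theorem exists_dWalk_reverseEdge_of_not_consecutive (hG : Acyclic G) (hcov : Covered G i j)
    {C : Finset V} {n : ℕ} {f : ℕ → V} {x y : V} (h : DWalk G C n f x y)
    (hinj : ∀ s t, s ≤ n → t ≤ n → f s = f t → s = t)
    (hij : ∀ t, t < n → ¬ (f t = i ∧ f (t + 1) = j))
    (hji : ∀ t, t < n → ¬ (f t = j ∧ f (t + 1) = i)) :
    ∃ n f, DWalk (ReverseEdge G i j) C n f x y := by
  classical
  have hne : i ≠ j := by
    rintro rfl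
    exact hG.irrefl _ hcov.1
  have hadj : ∀ s, s < n → Adj (ReverseEdge G i j) (f s) (f (s + 1)) :=
    fun s hs => reverseEdge_adj (h.adj s hs)
  have hfar : ∀ s, 0 < s → s < n → f s ≠ i →
      Unblocked (ReverseEdge G i j) C (f (s - 1)) (f s) (f (s + 1)) := fun s h0 hs h1 => by
    refine (h.unblocked s h0 hs).reverseEdge hcov h1 (fun h' => ?_) fun h' => ?_
    · exact hij (s - 1) (by omega) (by rwa [Nat.sub_add_cancel h0])
    · exact hji s hs h'.symm
  by_cases hall : ∀ s, 0 < s → s < n →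
      Unblocked (ReverseEdge G i j) C (f (s - 1)) (f s) (f (s + 1))
  · exact ⟨n, f, h.source, h.target, hadj, hall⟩
  push Not at hall
  obtain ⟨t, h0, ht, hbl⟩ := hall
  have hti : f t = i := by
    by_contra h'
    exact hbl (hfar t h0 ht h')
  have hpj : f (t - 1) ≠ j := fun h' =>
    hji (t - 1) (by omega) ⟨h', by rwa [Nat.sub_add_cancel h0]⟩
  have hsj : f (t + 1) ≠ j := fun h' => hij t ht ⟨hti, h'⟩
  have hi : ∀ s, s ≤ n → f s = i → s = t := fun s hs h' => hinj s t hs ht.le (h'.trans hti.symm)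
  have hiff : (ReverseEdge G i j (f (t - 1)) i ∧ ReverseEdge G i j (f (t + 1)) i) ↔
      (G (f (t - 1)) i ∧ G (f (t + 1)) i) := by
    unfold ReverseEdge
    grind
  have ut := h.unblocked t h0 ht
  rw [hti] at ut hbl
  have hcol : G (f (t - 1)) i ∧ G (f (t + 1)) i := by
    by_contra hc
    exact hbl (.of_not_collider (hiff.not.2 hc) (ut.2 hc))
  obtain ⟨d, hd, hid⟩ := ut.1 hcol
  have hjd : Desc (ReverseEdge G i j) j d :=
    (reverseEdge_desc_source hG hcov hid).resolve_left fun h' =>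
      hbl ⟨fun _ => ⟨d, hd, h'⟩, fun hc => absurd (hiff.2 hcol) hc⟩
  have hpar : ∀ a, G a i → ReverseEdge G i j a j := fun a ha =>
    .inl ⟨((hcov.2 a).1 ha).1, fun h' => ((hcov.2 a).1 ha).2 h'.1⟩
  have hG' := reverseEdge_acyclic hG hcov
  have hp := hpar _ hcol.1
  have hs := hpar _ hcol.2
  refine ⟨n, Function.update f t j, ?_, ?_, ?_, ?_⟩
  · rw [Function.update_of_ne (by omega), h.source]
  · rw [Function.update_of_ne (by omega), h.target]
  · intro s hsn
    by_cases h1 : s = t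
    · subst h1
      rw [Function.update_self, Function.update_of_ne (by omega)]
      exact .inr hs
    by_cases h2 : s + 1 = t
    · subst h2
      rw [Function.update_self, Function.update_of_ne (by omega)]
      exact .inl hp
    rw [Function.update_of_ne h1, Function.update_of_ne h2]
    exact hadj s hsn
  · intro s hs0 hsn
    by_cases h1 : s = t
    · subst h1
      rw [Function.update_self, Function.update_of_ne (by omega), Function.update_of_ne (by omega)]
      exact ⟨fun _ => ⟨d, hd, hjd⟩, fun hc => absurd ⟨hp, hs⟩ hc⟩
    rw [Function.update_of_ne h1]
    by_cases h2 : s + 1 = t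
    · subst h2
      rw [Function.update_self, Function.update_of_ne (by omega)]
      refine .of_not_collider (fun h' => hG'.asymm hp h'.2) ((h.unblocked s hs0 hsn).2 fun h' => ?_)
      rw [hti] at h'
      exact hG.asymm hcol.1 h'.2
    rw [Function.update_of_ne h2]
    by_cases h3 : s - 1 = t
    · subst h3
      rw [Function.update_self]
      rw [Nat.sub_add_cancel hs0] at hs hcol
      refine .of_not_collider (fun h' => hG'.asymm hs h'.1) ((h.unblocked s hs0 hsn).2 fun h' => ?_)
      rw [hti] at h'
      exact hG.asymm hcol.2 h'.1
    rw [Function.update_of_ne h3]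
    exact hfar s hs0 hsn fun h' => h1 (hi s hsn.le h')

theorem exists_dWalk_reverseEdge (hG : Acyclic G) (hcov : Covered G i j)
    {C : Finset V} {n : ℕ} {f : ℕ → V} {x y : V} (hp : IsPath G n f x y) (hd : DConn G n f C) :
    ∃ n f, DWalk (ReverseEdge G i j) C n f x y := by
  have h := hp.dWalk hd
  have hinj := hp.2.2.2.1
  by_cases hij : ∃ t, t < n ∧ f t = i ∧ f (t + 1) = j
  · obtain ⟨t, ht, hti, htj⟩ := hij
    exact exists_dWalk_reverseEdge_of_consecutive hG hcov h hinj ht hti htj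
  by_cases hji : ∃ t, t < n ∧ f t = j ∧ f (t + 1) = i
  · obtain ⟨t, ht, htj, hti⟩ := hji
    obtain ⟨m, g, hg⟩ := exists_dWalk_reverseEdge_of_consecutive hG hcov h.reverse
      (fun s r hs hr heq => by
        have := hinj _ _ (Nat.sub_le n s) (Nat.sub_le n r) heq
        omega)
      (t := n - (t + 1)) (by omega)
      (by rwa [show n - (n - (t + 1)) = t + 1 by omega])
      (by rwa [show n - (n - (t + 1) + 1) = t by omega])
    exact ⟨m, _, hg.reverse⟩
  exact exists_dWalk_reverseEdge_of_not_consecutive hG hcov h hinj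
    (fun t ht h' => hij ⟨t, ht, h'⟩) (fun t ht h' => hji ⟨t, ht, h'⟩)

theorem indep_reverseEdge_subset (hG : Acyclic G) (hcov : Covered G i j) :
    Indep (ReverseEdge G i j) ⊆ Indep G := by
  rintro ⟨x, y, C⟩ ⟨hxy, hx, hy, hsep⟩
  refine ⟨hxy, hx, hy, fun n f hp hd => ?_⟩
  obtain ⟨m, g, hp', hd'⟩ := DWalk.exists_path (reverseEdge_acyclic hG hcov) hxy
    (exists_dWalk_reverseEdge hG hcov hp hd)
  exact hsep m g hp' hd'

end Reversal

/-- **Covered edge reversal.** If `G` is a DAG on `Fin p`, `i → j` is a covered edge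
of `G`, and `G'` is obtained from `G` by reversing this edge (keeping all other
edges), then `G'` is a DAG and `G` and `G'` are Markov equivalent. -/
theorem coveredEdgeReversal_acyclic_markovEquiv {p : ℕ} (G : Fin p → Fin p → Prop)
    (hG : Acyclic G) (i j : Fin p) (hcov : Covered G i j) :
    Acyclic (ReverseEdge G i j) ∧ MarkovEquiv G (ReverseEdge G i j) := by
  have hG' := reverseEdge_acyclic hG hcov
  refine ⟨hG', Set.Subset.antisymm ?_ (indep_reverseEdge_subset hG hcov)⟩
  have h := indep_reverseEdge_subset hG' (covered_reverseEdge hG hcov)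
  rwa [reverseEdge_reverseEdge hG hcov] at h

end CausalDiscovery
end

section
/- (Meek's conjecture, proved by Chickering.) Let G and H be DAGs on Fin p such that H is an independence map of G, i.e., I(H) ⊆ I(G). Then there exists a finite sequence of DAGs G = G_0, G_1, …, G_M = H in which each G_{t+1} is obtained from G_t either by adding a single directed edge or by reversing a single covered edge of G_t. -/
namespace CausalDiscovery

variable {V : Type*}

/-- The graph obtained by adding the directed edge `a → b`. -/
def AddEdge (E : V → V → Prop) (a b : V) : V → V → Prop :=
  fun x y => E x y ∨ (x = a ∧ y = b)

/-- One step of Chickering's sequence: `E'` (a DAG) is obtained from the DAG `E`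
either by reversing a single covered edge of `E` or by adding a single directed
edge to `E`. -/
def MeekStep (E E' : V → V → Prop) : Prop :=
  Acyclic E ∧ Acyclic E' ∧
    ((∃ i j, Covered E i j ∧ E' = ReverseEdge E i j) ∨
      ∃ a b, ¬ E a b ∧ E' = AddEdge E a b)

/-! ### Acyclicity and topological orders -/

theorem acyclic_of_rank {α : Type*} [Preorder α] {E : V → V → Prop} (r : V → α)
    (h : ∀ a b, E a b → r a < r b) : Acyclic E := by
  intro v hv
  have key : ∀ a b, Relation.TransGen E a b → r a < r b := by
    intro a b hab
    induction hab with
    | single h1 => exact h _ _ h1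
    | tail _ h2 ih => exact ih.trans (h _ _ h2)
  exact lt_irrefl _ (key v v hv)

theorem Acyclic.exists_rank {p : ℕ} {E : Fin p → Fin p → Prop} (hE : Acyclic E) :
    ∃ r : Fin p → ℕ, Function.Injective r ∧ ∀ a b, E a b → r a < r b := by
  classical
  let c : Fin p → ℕ := fun v => (Finset.univ.filter fun u => Relation.TransGen E u v).card
  have hc : ∀ a b, E a b → c a < c b := by
    intro a b hab
    apply Finset.card_lt_card
    rw [Finset.ssubset_iff_of_subset]
    · exact ⟨a, by simpa using Relation.TransGen.single hab, by simpa using hE a⟩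
    · intro u hu
      simp only [Finset.mem_filter, Finset.mem_univ, true_and] at hu ⊢
      exact hu.tail hab
  refine ⟨fun v => v.val + p * c v, ?_, ?_⟩
  · intro a b hab
    have h1 := congrArg (· % p) hab
    simp only [Nat.add_mul_mod_self_left, Nat.mod_eq_of_lt a.isLt, Nat.mod_eq_of_lt b.isLt] at h1
    exact Fin.ext h1
  · intro a b hab
    have h1 := Nat.mul_le_mul_left p (hc a b hab)
    have h2 := a.isLt
    simp only [Nat.succ_eq_add_one, Nat.mul_add] at h1
    simp only
    omega

theorem Desc.rank_le {E : V → V → Prop} {r : V → ℕ} (hr : ∀ a b, E a b → r a < r b)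
    {a b : V} (h : Desc E a b) : r a ≤ r b := by
  induction h with
  | refl => exact le_rfl
  | tail _ h2 ih => exact ih.trans (hr _ _ h2).le

/-- A subgraph of a DAG can be completed to it by adding one edge at a time. -/
theorem reflTransGen_meekStep_of_le [Finite V] {E E' : V → V → Prop}
    (hE' : Acyclic E') (hle : ∀ a b, E a b → E' a b) :
    Relation.ReflTransGen MeekStep E E' := by
  have sub : ∀ F : V → V → Prop, (∀ a b, F a b → E' a b) → Acyclic F :=
    fun F hF v hv => hE' v (Relation.TransGen.mono hF v v hv)
  induction hk : {x : V × V | E' x.1 x.2 ∧ ¬ E x.1 x.2}.ncard using Nat.strong_induction_on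
    generalizing E with
  | _ k ih =>
    by_cases hne : ∃ a b, E' a b ∧ ¬ E a b
    · obtain ⟨a, b, hab, hnab⟩ := hne
      have hle' : ∀ x y, AddEdge E a b x y → E' x y := by
        rintro x y (h | ⟨rfl, rfl⟩)
        · exact hle _ _ h
        · exact hab
      refine Relation.ReflTransGen.head (b := AddEdge E a b)
        ⟨sub _ hle, sub _ hle', Or.inr ⟨a, b, hnab, rfl⟩⟩ (ih _ ?_ hle' rfl)
      rw [← hk]
      apply Set.ncard_lt_ncard _ (Set.toFinite _)
      refine ⟨fun x hx => ⟨hx.1, fun h => hx.2 (Or.inl h)⟩, fun h => ?_⟩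
      exact (h (show (a, b) ∈ _ from ⟨hab, hnab⟩)).2 (Or.inr ⟨rfl, rfl⟩)
    · have : E = E' := by
        funext a b
        exact propext ⟨hle a b, fun h => by_contra fun h' => hne ⟨a, b, h, h'⟩⟩
      rw [this]

/-! ### Moral connection -/

/-- `x` is an ancestor of the set `T`. -/
def Anc (E : V → V → Prop) (T : Set V) (x : V) : Prop :=
  ∃ t ∈ T, Desc E x t

/-- Adjacency in the moral graph of the subgraph induced on the ancestors of `T`. -/
def Moral (E : V → V → Prop) (T : Set V) (x y : V) : Prop :=
  Anc E T x ∧ Anc E T y ∧ (E x y ∨ E y x ∨ ∃ w, Anc E T w ∧ E x w ∧ E y w)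

/-- `i` and `j` are joined by a path of the moral graph on the ancestors of `T` whose interior
avoids `T`. -/
def MoralConn (E : V → V → Prop) (T : Set V) (i j : V) : Prop :=
  ∃ x, Relation.ReflTransGen (fun x y => Moral E T x y ∧ y ∉ T) i x ∧ Moral E T x j

theorem Anc.head {E : V → V → Prop} {T : Set V} {x y : V} (h : E x y) (hy : Anc E T y) :
    Anc E T x := by
  obtain ⟨t, ht, hd⟩ := hy
  exact ⟨t, ht, Relation.ReflTransGen.head h hd⟩

theorem Anc.of_mem {E : V → V → Prop} {T : Set V} {x : V} (h : x ∈ T) : Anc E T x :=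
  ⟨x, h, Relation.ReflTransGen.refl⟩

/-! ### Covering an edge and reversing it -/

/-- The graph obtained by adding the edges that make `Y → Z` covered. -/
def CoverEdge (E : V → V → Prop) (Y Z : V) : V → V → Prop :=
  fun a b => E a b ∨ (b = Z ∧ E a Y) ∨ (b = Y ∧ E a Z ∧ a ≠ Y)

theorem coverEdge_acyclic {E : V → V → Prop} {r : V → ℕ} (hr : ∀ a b, E a b → r a < r b)
    {Y Z : V} (hYZ : E Y Z) (hZ : ∀ a, Desc E Y a → a ≠ Y → ¬ E a Z) :
    Acyclic (CoverEdge E Y Z) ∧ Acyclic (ReverseEdge (CoverEdge E Y Z) Y Z) := by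
  classical
  have hback : ∀ a, E a Y → ¬ Desc E Y a := fun a h hd =>
    absurd (Desc.rank_le hr hd) (not_le.2 (hr _ _ h))
  have hdY : Desc E Y Y := Relation.ReflTransGen.refl
  have htail : ∀ a b, Desc E Y a → E a b → Desc E Y b := fun a b h h' => h.tail h'
  let c : ℕ → ℕ → V → ℕ := fun k l v =>
    if v = Y then k else if v = Z then l else if Desc E Y v then 3 else 0
  constructor
  · refine acyclic_of_rank (fun v => toLex (c 1 2 v, r v)) fun a b hab => ?_
    rw [Prod.Lex.toLex_lt_toLex]
    simp only [c]
    rcases hab with h | ⟨rfl, h⟩ | ⟨rfl, h, h'⟩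
    · have := hr _ _ h
      grind
    · grind
    · grind
  · refine acyclic_of_rank (fun v => toLex (c 2 1 v, r v)) fun a b hab => ?_
    rw [Prod.Lex.toLex_lt_toLex]
    simp only [c]
    rcases hab with ⟨h | ⟨rfl, h⟩ | ⟨rfl, h, h'⟩, h2⟩ | ⟨rfl, rfl⟩
    · have := hr _ _ h
      grind
    · grind
    · grind
    · grind

theorem coverEdge_covered {E : V → V → Prop} (hirr : ∀ a, ¬ E a a)
    {Y Z : V} (hYZ : E Y Z) : Covered (CoverEdge E Y Z) Y Z := by
  refine ⟨Or.inl hYZ, fun k => ?_⟩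
  have h1 := hirr Y
  have h2 := hirr Z
  unfold CoverEdge
  grind

/-- Every edge of the moral graph after covering and reversing `Y → Z` is, in the original
moral graph, an edge or a path through `Y`. -/
theorem moral_of_reverse_coverEdge {E : V → V → Prop} {Y Z : V} (hYZ : E Y Z) {T : Set V}
    (hT : Anc E T Z ∨ ¬ Anc E T Y) {x y : V}
    (hxy : Moral (ReverseEdge (CoverEdge E Y Z) Y Z) T x y) :
    Moral E T x y ∨ (Moral E T x Y ∧ Moral E T Y y) := by
  have hedge : ∀ a b, ReverseEdge (CoverEdge E Y Z) Y Z a b → Anc E T b → Anc E T a := by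
    rintro a b (⟨h | ⟨hbZ, h⟩ | ⟨rfl, h, h'⟩, h2⟩ | ⟨rfl, rfl⟩) hb
    · exact hb.head h
    · subst hbZ
      exact (hb.head hYZ).head h
    · rcases hT with hT | hT
      · exact hT.head h
      · exact absurd hb hT
    · rcases hT with hT | hT
      · exact hT
      · exact absurd hb hT
  have hanc : ∀ a, Anc (ReverseEdge (CoverEdge E Y Z) Y Z) T a → Anc E T a := by
    rintro a ⟨t, ht, hd⟩
    induction hd using Relation.ReflTransGen.head_induction_on with
    | refl => exact Anc.of_mem ht
    | head h1 _ ih => exact hedge _ _ h1 ih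
  have hYT : ∀ b, (b = Y ∨ b = Z) → Anc E T b → Anc E T Y ∧ Anc E T Z := by
    rintro b (rfl | rfl) hb
    · exact ⟨hb, hT.resolve_right (not_not.2 hb)⟩
    · exact ⟨hb.head hYZ, hb⟩
  obtain ⟨hx, hy, h⟩ := hxy
  replace hx := hanc _ hx
  replace hy := hanc _ hy
  unfold Moral
  unfold ReverseEdge CoverEdge at h
  rcases h with h | h | ⟨w, hw, h1, h2⟩
  · grind
  · grind
  · replace hw := hanc _ hw
    grind

/-! ### Reaching the target graph -/

/-- The invariant kept while the vertices are put in their final position from last to first: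
the vertices of rank at least `n` are final, and the moral connections between the earlier ones
are edges of `H`. -/
structure Invariant (H : V → V → Prop) (r : V → ℕ) (n : ℕ) (G : V → V → Prop) : Prop where
  acyclic : Acyclic G
  le : ∀ a b, n ≤ r b → G a b → H a b
  up : ∀ a b, n ≤ r a → G a b → n ≤ r b
  conn : ∀ i j, r i < r j → r j < n → MoralConn G {v | r v ≤ r j} i j → H i j

theorem Invariant.exists_coverEdge {p : ℕ} {H G : Fin p → Fin p → Prop} {r : Fin p → ℕ}
    {n : ℕ} {Y W : Fin p} (hinv : Invariant H r (n + 1) G) (hY : r Y = n) (hW : G Y W)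
    (hWn : r W < n) (hinj : Function.Injective r) :
    ∃ Z, G Y Z ∧ r Z < n ∧ Relation.ReflTransGen MeekStep G (ReverseEdge (CoverEdge G Y Z) Y Z) ∧
      Invariant H r (n + 1) (ReverseEdge (CoverEdge G Y Z) Y Z) := by
  classical
  obtain ⟨q, -, hq⟩ := hinv.acyclic.exists_rank
  have hirr : ∀ a, ¬ G a a := fun a h => lt_irrefl _ (hq _ _ h)
  obtain ⟨D, ⟨hYD, hDY⟩, hDmin⟩ := Set.exists_min_image {v | Desc G Y v ∧ v ≠ Y} r
    (Set.toFinite _) ⟨W, Relation.ReflTransGen.single hW, by rintro rfl; exact hirr _ hW⟩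
  have hDn : r D < n := (hDmin W ⟨Relation.ReflTransGen.single hW,
    by rintro rfl; exact hirr _ hW⟩).trans_lt hWn
  have hchild : ∀ v, Desc G Y v → v ≠ Y → ∃ z, G Y z ∧ Desc G z v := by
    intro v hv hne
    rcases Relation.ReflTransGen.cases_head hv with rfl | h
    · exact absurd rfl hne
    · exact h
  obtain ⟨Z, ⟨hYZ, hZD⟩, hZmin⟩ := Set.exists_min_image {z | G Y z ∧ Desc G z D} q
    (Set.toFinite _) (hchild D hYD hDY)
  have hZ : ∀ a, Desc G Y a → a ≠ Y → ¬ G a Z := by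
    intro a ha hne haZ
    obtain ⟨z, hz, hza⟩ := hchild a ha hne
    have h1 := hZmin z ⟨hz, hza.trans (Relation.ReflTransGen.head haZ hZD)⟩
    have h2 := Desc.rank_le hq hza
    have h3 := hq _ _ haZ
    omega
  have hZn : r Z < n := by
    by_contra hcon
    have hZY : r Z ≠ n := by
      intro h
      have : Z = Y := hinj (h.trans hY.symm)
      exact hirr Y (this ▸ hYZ)
    have : ∀ v, Desc G Z v → n + 1 ≤ r v := by
      intro v hv
      induction hv with
      | refl => omega
      | tail _ h ih => exact hinv.up _ _ ih h
    have := this D hZD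
    omega
  obtain ⟨hac, har⟩ := coverEdge_acyclic hq hYZ hZ
  have hmoral : ∀ T : Set (Fin p), (D ∈ T ∨ ¬ Anc G T Y) → ∀ x y,
      Moral (ReverseEdge (CoverEdge G Y Z) Y Z) T x y →
        Moral G T x y ∨ (Moral G T x Y ∧ Moral G T Y y) := by
    intro T hT x y
    exact moral_of_reverse_coverEdge hYZ (hT.imp_left fun h => ⟨D, h, hZD⟩)
  have hup : ∀ a b, n + 1 ≤ r a → ReverseEdge (CoverEdge G Y Z) Y Z a b → n + 1 ≤ r b := by
    rintro a b ha (⟨h | ⟨rfl, h⟩ | ⟨rfl, h, h'⟩, h2⟩ | ⟨rfl, rfl⟩)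
    · exact hinv.up _ _ ha h
    · have := hinv.up _ _ ha h
      omega
    · have := hinv.up _ _ ha h
      omega
    · omega
  refine ⟨Z, hYZ, hZn, ?_, har, ?_, hup, ?_⟩
  · exact (reflTransGen_meekStep_of_le hac fun a b h => Or.inl h).tail
      ⟨hac, har, Or.inl ⟨Y, Z, coverEdge_covered hirr hYZ, rfl⟩⟩
  · rintro a b hb (⟨h | ⟨rfl, h⟩ | ⟨rfl, h, h'⟩, h2⟩ | ⟨rfl, rfl⟩)
    · exact hinv.le _ _ hb h
    all_goals omega
  · rintro i j hij hj ⟨x, hix, hxj⟩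
    refine hinv.conn i j hij hj ?_
    by_cases hjY : j = Y
    · subst hjY
      have hx : x = i := by
        rcases Relation.ReflTransGen.cases_tail hix with h | ⟨z, -, ⟨-, ⟨t, ht, hxt⟩, -⟩, hxT⟩
        · exact h
        · exfalso
          have : ∀ v, Desc (ReverseEdge (CoverEdge G j Z) j Z) x v → n + 1 ≤ r v := by
            intro v hv
            induction hv with
            | refl =>
              simp only [Set.mem_ofPred_eq] at hxT
              omega
            | tail _ h ih => exact hup _ _ ih h
          have := this t hxt
          simp only [Set.mem_ofPred_eq] at ht
          omega
      subst hx
      refine ⟨x, Relation.ReflTransGen.refl, ?_⟩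
      rcases hmoral _ (Or.inl (show r D ≤ r j by omega)) _ _ hxj with h | h
      · exact h
      · exact h.1
    · have hjn : r j < n := by
        have : r j ≠ n := fun h => hjY (hinj (h.trans hY.symm))
        omega
      have hYT : Y ∉ {v | r v ≤ r j} := by
        simp only [Set.mem_ofPred_eq]
        omega
      have hM := hmoral {v | r v ≤ r j} (by
        by_cases hD : r D ≤ r j
        · exact Or.inl hD
        · right
          rintro ⟨t, ht, hYt⟩
          have := hDmin t ⟨hYt, by rintro rfl; exact hYT ht⟩
          simp only [Set.mem_ofPred_eq] at ht
          omega)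
      have hwalk : Relation.ReflTransGen
          (fun x y => Moral G {v | r v ≤ r j} x y ∧ y ∉ {v | r v ≤ r j}) i x := by
        clear hxj
        induction hix with
        | refl => exact Relation.ReflTransGen.refl
        | tail _ h ih =>
          rcases hM _ _ h.1 with h1 | h1
          · exact ih.tail ⟨h1, h.2⟩
          · exact (ih.tail ⟨h1.1, hYT⟩).tail ⟨h1.2, h.2⟩
      rcases hM _ _ hxj with h | h
      · exact ⟨x, hwalk, h⟩
      · exact ⟨Y, hwalk.tail ⟨h.1, hYT⟩, h.2⟩

theorem Invariant.exists_pred {p : ℕ} {H : Fin p → Fin p → Prop} {r : Fin p → ℕ}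
    (hinj : Function.Injective r) {n : ℕ} {G : Fin p → Fin p → Prop}
    (hinv : Invariant H r (n + 1) G) :
    ∃ G', Relation.ReflTransGen MeekStep G G' ∧ Invariant H r n G' := by
  by_cases hY : ∃ Y, r Y = n
  · obtain ⟨Y, hY⟩ := hY
    induction hk : {z | G Y z ∧ r z < n}.ncard using Nat.strong_induction_on generalizing G with
    | _ k ih =>
      by_cases hW : ∃ W, G Y W ∧ r W < n
      · obtain ⟨W, hW, hWn⟩ := hW
        obtain ⟨Z, hYZ, hZn, hreach, hinv'⟩ := hinv.exists_coverEdge hY hW hWn hinj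
        have hne : Y ≠ Z := by
          rintro rfl
          omega
        obtain ⟨G', h1, h2⟩ := ih _ (by
          rw [← hk]
          apply Set.ncard_lt_ncard _ (Set.toFinite _)
          refine ⟨?_, fun h => ?_⟩
          · rintro z ⟨⟨h | ⟨rfl, h⟩ | ⟨rfl, h, h'⟩, h2⟩ | ⟨h, -⟩, hz⟩
            · exact ⟨h, hz⟩
            · exact ⟨hYZ, hz⟩
            · exact absurd rfl h'
            · exact absurd h hne
          · rcases (h (show Z ∈ _ from ⟨hYZ, hZn⟩)).1 with ⟨-, h⟩ | ⟨h, -⟩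
            · exact h ⟨rfl, rfl⟩
            · exact hne h) hinv' rfl
        exact ⟨G', hreach.trans h1, h2⟩
      · have hirr : ∀ a, ¬ G a a := fun a h => hinv.acyclic a (Relation.TransGen.single h)
        have hcase : ∀ a, n ≤ r a → a = Y ∨ n + 1 ≤ r a := by
          intro a ha
          rcases ha.eq_or_lt with h | h
          · exact Or.inl (hinj (h.symm.trans hY.symm))
          · exact Or.inr h
        refine ⟨G, Relation.ReflTransGen.refl, hinv.acyclic, ?_, ?_, ?_⟩
        · intro a b hb hab
          rcases hcase b hb with rfl | hb
          · have ha : r a < r b := by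
              by_contra hcon
              rcases hcase a (by omega) with rfl | ha
              · exact hirr _ hab
              · have := hinv.up _ _ ha hab
                omega
            exact hinv.conn a b ha (by omega) ⟨a, Relation.ReflTransGen.refl,
              Anc.of_mem (show r a ≤ r b from ha.le),
              Anc.of_mem (show r b ≤ r b from le_rfl), Or.inl hab⟩
          · exact hinv.le _ _ hb hab
        · intro a b ha hab
          rcases hcase a ha with rfl | ha
          · by_contra hcon
            exact hW ⟨b, hab, by omega⟩
          · have := hinv.up _ _ ha hab
            omega
        · intro i j hij hj
          exact hinv.conn i j hij (by omega)
  · push Not at hY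
    refine ⟨G, Relation.ReflTransGen.refl, hinv.acyclic, ?_, ?_, ?_⟩
    · intro a b hb
      have := hY b
      exact hinv.le a b (by omega)
    · intro a b ha hab
      have := hY a
      have := hinv.up a b (by omega) hab
      omega
    · intro i j hij hj
      exact hinv.conn i j hij (by omega)

theorem Invariant.reflTransGen_meekStep {p : ℕ} {H : Fin p → Fin p → Prop} {r : Fin p → ℕ}
    (hH : Acyclic H) (hinj : Function.Injective r) {n : ℕ} {G : Fin p → Fin p → Prop}
    (hinv : Invariant H r n G) : Relation.ReflTransGen MeekStep G H := by
  induction n generalizing G with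
  | zero => exact reflTransGen_meekStep_of_le hH fun a b => hinv.le a b (Nat.zero_le _)
  | succ n ih =>
    obtain ⟨G', h1, h2⟩ := hinv.exists_pred hinj
    exact h1.trans (ih h2)

/-! ### d-connecting walks -/

/-- `f 0, …, f n` is a d-connecting walk from `i` to `x` given `C`; vertices may repeat. -/
structure DWalk_s3 (E : V → V → Prop) (C : Finset V) (i x : V) (n : ℕ) (f : ℕ → V) : Prop where
  pos : 0 < n
  first : f 0 = i
  last : f n = x
  adj : ∀ t, t < n → Adj E (f t) (f (t + 1))
  dconn : DConn E n f C

/-- Some d-connecting walk from `i` to `x` ends with an edge into `x`. -/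
def ReachIn (E : V → V → Prop) (C : Finset V) (i x : V) : Prop :=
  ∃ n f, DWalk_s3 E C i x n f ∧ E (f (n - 1)) x

/-- Some d-connecting walk from `i` to `x` ends with an edge out of `x`. -/
def ReachOut (E : V → V → Prop) (C : Finset V) (i x : V) : Prop :=
  ∃ n f, DWalk_s3 E C i x n f ∧ E x (f (n - 1))

theorem dwalk_single {E : V → V → Prop} {C : Finset V} {i x : V} (h : Adj E i x) :
    DWalk_s3 E C i x 1 (fun t => if t = 0 then i else x) := by
  refine ⟨one_pos, by simp, by simp, ?_, ?_⟩
  · intro t ht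
    obtain rfl : t = 0 := by omega
    simpa using h
  · intro t h1 h2
    omega

theorem DWalk_s3.snoc {E : V → V → Prop} {C : Finset V} {i x y : V} {n : ℕ} {f : ℕ → V}
    (hf : DWalk_s3 E C i x n f) (hxy : Adj E x y)
    (hc : E (f (n - 1)) x → E y x → x ∈ C ∨ ∃ d ∈ C, Desc E x d)
    (hn : ¬ (E (f (n - 1)) x ∧ E y x) → x ∉ C) :
    DWalk_s3 E C i y (n + 1) (fun t => if t ≤ n then f t else y) := by
  refine ⟨Nat.succ_pos _, by simp [hf.first], by simp, ?_, ?_⟩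
  · intro t ht
    rcases (Nat.lt_succ_iff.1 ht).eq_or_lt with rfl | h
    · simpa [hf.last] using hxy
    · simpa [h.le, Nat.succ_le_of_lt h] using hf.adj t h
  · intro t h0 ht
    rcases (Nat.lt_succ_iff.1 ht).eq_or_lt with rfl | h
    · simp only [ColliderAt, le_refl, if_true, Nat.sub_le, hf.last,
        show ¬ (t + 1 ≤ t) by omega, if_false]
      exact ⟨fun h => hc h.1 h.2, hn⟩
    · have := hf.dconn t h0 h
      simpa only [ColliderAt, h.le, if_true, show t - 1 ≤ n by omega,
        show t + 1 ≤ n by omega] using this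

theorem ReachIn.forward {E : V → V → Prop} {C : Finset V} {i x y : V} (hE : Acyclic E)
    (h : ReachIn E C i x ∨ ReachOut E C i x) (hx : x ∉ C) (hxy : E x y) : ReachIn E C i y := by
  have hyx : ¬ E y x := fun h' => hE x ((Relation.TransGen.single hxy).tail h')
  obtain ⟨n, f, hf⟩ : ∃ n f, DWalk_s3 E C i x n f := by
    rcases h with ⟨n, f, hf, -⟩ | ⟨n, f, hf, -⟩ <;> exact ⟨n, f, hf⟩
  refine ⟨_, _, hf.snoc (Or.inl hxy) (fun _ h' => absurd h' hyx) (fun _ => hx), ?_⟩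
  simpa [hf.last] using hxy

theorem ReachIn.collide {E : V → V → Prop} {C : Finset V} {i x y : V}
    (h : ReachIn E C i x) (hx : ∃ d ∈ C, Desc E x d) (hyx : E y x) : ReachOut E C i y := by
  obtain ⟨n, f, hf, hfx⟩ := h
  refine ⟨_, _, hf.snoc (Or.inr hyx) (fun _ _ => Or.inr hx) (fun h' => absurd ⟨hfx, hyx⟩ h'), ?_⟩
  simpa [hf.last] using hyx

theorem ReachOut.backward {E : V → V → Prop} {C : Finset V} {i x y : V} (hE : Acyclic E)
    (h : ReachOut E C i x) (hx : x ∉ C) (hyx : E y x) : ReachOut E C i y := by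
  obtain ⟨n, f, hf, hfx⟩ := h
  have hno : ¬ E (f (n - 1)) x := fun h' => hE x ((Relation.TransGen.single hfx).tail h')
  refine ⟨_, _, hf.snoc (Or.inr hyx) (fun h' => absurd h' hno) (fun _ => hx), ?_⟩
  simpa [hf.last] using hyx

theorem ReachIn.single {E : V → V → Prop} {C : Finset V} {i x : V} (h : E i x) :
    ReachIn E C i x :=
  ⟨1, _, dwalk_single (Or.inl h), by simpa using h⟩

theorem ReachOut.single {E : V → V → Prop} {C : Finset V} {i x : V} (h : E x i) :
    ReachOut E C i x :=
  ⟨1, _, dwalk_single (Or.inr h), by simpa using h⟩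

theorem reachIn_of_desc {E : V → V → Prop} (hE : Acyclic E) {C : Finset V} {i x y : V}
    (h : ReachIn E C i x) (hx : ¬ ∃ d ∈ C, Desc E x d) (hxy : Desc E x y) : ReachIn E C i y := by
  induction hxy with
  | refl => exact h
  | tail h1 h2 ih => exact ReachIn.forward hE (Or.inl ih) (fun hc => hx ⟨_, hc, h1⟩) h2

theorem reachOut_of_desc {E : V → V → Prop} (hE : Acyclic E) {C : Finset V} {i x : V}
    (hx : ¬ ∃ d ∈ C, Desc E x d) (hxi : Desc E x i) : x = i ∨ ReachOut E C i x := by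
  induction hxi using Relation.ReflTransGen.head_induction_on with
  | refl => exact Or.inl rfl
  | head h1 h2 ih =>
    right
    have hc : ¬ ∃ d ∈ C, Desc E _ d := fun ⟨d, hd, hcd⟩ =>
      hx ⟨d, hd, Relation.ReflTransGen.head h1 hcd⟩
    rcases ih hc with rfl | h
    · exact ReachOut.single h1
    · exact h.backward hE (fun hcC => hc ⟨_, hcC, Relation.ReflTransGen.refl⟩) h1

/-- A walk arriving at an ancestor `w` of `C ∪ {i, j}` can be rerouted to reach `j` or to leave
`w` against an arrow. -/
theorem ReachIn.bounce {E : V → V → Prop} (hE : Acyclic E) {C : Finset V} {i j w y : V}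
    (h : ReachIn E C i w) (hw : (∃ d ∈ C, Desc E w d) ∨ Desc E w i ∨ Desc E w j) (hy : E y w) :
    ReachIn E C i j ∨ ReachOut E C i y := by
  by_cases hC : ∃ d ∈ C, Desc E w d
  · exact Or.inr (h.collide hC hy)
  · rcases hw.resolve_left hC with hi | hj
    · right
      rcases reachOut_of_desc hE hC hi with rfl | h'
      · exact ReachOut.single hy
      · exact h'.backward hE (fun hwC => hC ⟨_, hwC, Relation.ReflTransGen.refl⟩) hy
    · exact Or.inl (reachIn_of_desc hE h hC hj)

theorem exists_dwalk_of_moralConn {E : V → V → Prop} (hE : Acyclic E) {C : Finset V} {T : Set V}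
    {i j : V} (hi : i ∉ C) (hT : ∀ t ∈ T, t ∈ C ∨ t = i ∨ t = j) (hCT : ∀ c ∈ C, c ∈ T)
    (h : MoralConn E T i j) : ∃ n f, DWalk_s3 E C i j n f := by
  obtain ⟨z, hiz, hzj⟩ := h
  have hanc : ∀ w, Anc E T w → (∃ d ∈ C, Desc E w d) ∨ Desc E w i ∨ Desc E w j := by
    rintro w ⟨t, ht, hwt⟩
    rcases hT t ht with h | rfl | rfl
    · exact Or.inl ⟨t, h, hwt⟩
    · exact Or.inr (Or.inl hwt)
    · exact Or.inr (Or.inr hwt)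
  have hstep : ∀ x y, (x = i ∨ ReachIn E C i x ∨ ReachOut E C i x) → x ∉ C → Moral E T x y →
      ReachIn E C i j ∨ ReachIn E C i y ∨ ReachOut E C i y := by
    rintro x y hx hxC ⟨hxT, -, hxy⟩
    have hfor : ∀ w, E x w → ReachIn E C i w := by
      intro w hxw
      rcases hx with rfl | hx
      · exact ReachIn.single hxw
      · exact ReachIn.forward hE hx hxC hxw
    rcases hxy with hxy | hyx | ⟨w, hw, hxw, hyw⟩
    · exact Or.inr (Or.inl (hfor y hxy))
    · rcases hx with rfl | hx | hx
      · exact Or.inr (Or.inr (ReachOut.single hyx))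
      · exact (hx.bounce hE (hanc x hxT) hyx).imp_right Or.inr
      · exact Or.inr (Or.inr (hx.backward hE hxC hyx))
    · exact ((hfor w hxw).bounce hE (hanc w hw) hyw).imp_right Or.inr
  have hfin : ReachIn E C i j ∨ ReachOut E C i j := by
    have hz : ReachIn E C i j ∨
        ((z = i ∨ ReachIn E C i z ∨ ReachOut E C i z) ∧ z ∉ C) := by
      clear hzj
      induction hiz with
      | refl => exact Or.inr ⟨Or.inl rfl, hi⟩
      | tail _ h ih =>
        rcases ih with ih | ⟨ih, hC⟩
        · exact Or.inl ih
        · exact (hstep _ _ ih hC h.1).imp_right fun h' => ⟨Or.inr h', fun hc => h.2 (hCT _ hc)⟩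
    rcases hz with hz | ⟨hz, hzC⟩
    · exact Or.inl hz
    · rcases hstep _ _ hz hzC hzj with h | h
      · exact Or.inl h
      · exact h
  rcases hfin with ⟨n, f, hf, -⟩ | ⟨n, f, hf, -⟩ <;> exact ⟨n, f, hf⟩

/-- Cutting out a closed part of a d-connecting walk leaves a d-connecting walk. -/
theorem DWalk_s3.cut {E : V → V → Prop} (hE : Acyclic E) {C : Finset V} {i j : V} (hij : i ≠ j)
    {n : ℕ} {f : ℕ → V} (hf : DWalk_s3 E C i j n f) {s t : ℕ} (hst : s < t) (htn : t ≤ n)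
    (heq : f s = f t) :
    DWalk_s3 E C i j (n - (t - s)) (fun k => if k ≤ s then f k else f (k + (t - s))) := by
  have hanti : ∀ a b, E a b → ¬ E b a := fun a b h h' =>
    hE a ((Relation.TransGen.single h).tail h')
  have hlast : (if n - (t - s) ≤ s then f (n - (t - s)) else f (n - (t - s) + (t - s))) = j := by
    split_ifs with h
    · obtain rfl : t = n := by omega
      rw [show t - (t - s) = s by omega, heq, hf.last]
    · rw [show n - (t - s) + (t - s) = n by omega, hf.last]
  refine ⟨?_, by simp [hf.first], hlast, ?_, ?_⟩
  · by_contra hcon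
    have h0 : n - (t - s) = 0 := by omega
    simp only [h0, Nat.zero_le, if_true, hf.first] at hlast
    exact hij hlast
  · intro k hk
    rcases lt_trichotomy k s with h | rfl | h
    · simpa [h.le, Nat.succ_le_of_lt h] using hf.adj k (by omega)
    · have := hf.adj t (by omega)
      simpa [heq, show k + 1 + (t - k) = t + 1 by omega] using this
    · have := hf.adj (k + (t - s)) (by omega)
      simpa [h.not_ge, show ¬ (k + 1 ≤ s) by omega, Nat.add_right_comm] using this
  · intro k h0 hk
    rcases lt_trichotomy k s with h | rfl | h
    · have := hf.dconn k h0 (by omega)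
      simpa only [ColliderAt, h.le, if_true, show k - 1 ≤ s by omega,
        show k + 1 ≤ s by omega] using this
    · simp only [ColliderAt, le_refl, if_true, show k - 1 ≤ k by omega,
        show ¬ (k + 1 ≤ k) by omega, if_false, show k + 1 + (t - k) = t + 1 by omega]
      have hs := hf.dconn k h0 (by omega)
      have ht := hf.dconn t (by omega) (by omega)
      simp only [ColliderAt] at hs ht
      constructor
      · rintro ⟨h1, h2⟩
        by_contra hcon
        have hns : ¬ E (f (k + 1)) (f k) := fun h => hcon (hs.1 ⟨h1, h⟩)
        have hnt : ¬ E (f (t - 1)) (f t) := fun h => by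
          rw [heq] at hcon h2
          exact hcon (ht.1 ⟨h, h2⟩)
        have key : ∀ m, k + 1 + m ≤ t → E (f (k + m)) (f (k + 1 + m)) ∧
            Desc E (f k) (f (k + 1 + m)) := by
          intro m
          induction m with
          | zero =>
            intro _
            have := (hf.adj k (by omega)).resolve_right hns
            exact ⟨this, Relation.ReflTransGen.single this⟩
          | succ m ih =>
            intro hm
            obtain ⟨ih1, ih2⟩ := ih (by omega)
            have hc := (hf.dconn (k + 1 + m) (by omega) (by omega)).1
            have he := (hf.adj (k + 1 + m) (by omega)).resolve_right (by
              intro h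
              have h3 := hc ⟨by rwa [show k + 1 + m - 1 = k + m by omega], h⟩
              rcases h3 with h3 | ⟨d, hd, h3⟩
              · exact hcon (Or.inr ⟨_, h3, ih2⟩)
              · exact hcon (Or.inr ⟨d, hd, ih2.trans h3⟩))
            rw [show k + (m + 1) = k + 1 + m by omega]
            exact ⟨he, ih2.tail he⟩
        have := (key (t - 1 - k) (by omega)).1
        rw [show k + (t - 1 - k) = t - 1 by omega, show k + 1 + (t - 1 - k) = t by omega] at this
        exact hnt this
      · intro hno
        by_cases h1 : E (f (k - 1)) (f k)
        · rw [heq]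
          exact ht.2 fun h => hno ⟨h1, heq ▸ h.2⟩
        · exact hs.2 fun h => h1 h.1
    · have := hf.dconn (k + (t - s)) (by omega) (by omega)
      have e1 : (if k - 1 ≤ s then f (k - 1) else f (k - 1 + (t - s))) = f (k + (t - s) - 1) := by
        split_ifs with h'
        · rw [show k - 1 = s by omega, heq]
          congr 1
          omega
        · congr 1
          omega
      simpa only [ColliderAt, h.not_ge, if_false, show ¬ (k + 1 ≤ s) by omega, e1,
        show k + 1 + (t - s) = k + (t - s) + 1 by omega] using this

theorem DWalk_s3.not_dsep {E : V → V → Prop} (hE : Acyclic E) {C : Finset V} {i j : V} (hij : i ≠ j)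
    {n : ℕ} {f : ℕ → V} (hf : DWalk_s3 E C i j n f) : ¬ DSep E i j C := by
  induction n using Nat.strong_induction_on generalizing f with
  | _ n ih =>
    by_cases hinj : ∃ s t, s < t ∧ t ≤ n ∧ f s = f t
    · obtain ⟨s, t, hst, htn, heq⟩ := hinj
      exact ih _ (by omega) (hf.cut hE hij hst htn heq)
    · intro hsep
      refine hsep n f ⟨hf.pos, hf.first, hf.last, fun s t hs ht h => ?_, hf.adj⟩ hf.dconn
      rcases lt_trichotomy s t with h' | h' | h'
      · exact absurd ⟨s, t, h', ht, h⟩ hinj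
      · exact h'
      · exact absurd ⟨t, s, h', hs, h.symm⟩ hinj

/-- Nonadjacent vertices are d-separated given the other predecessors of the later one. -/
theorem dsep_of_rank {E : V → V → Prop} {r : V → ℕ}
    (hr : ∀ a b, E a b → r a < r b) {i j : V} (hij : r i < r j) (hE : ¬ E i j)
    {C : Finset V} (hC : ∀ v, v ∈ C ↔ r v < r j ∧ v ≠ i) : DSep E i j C := by
  rintro n f ⟨hn, h0, hnj, hf, hadj⟩ hconn
  have hlast := hadj (n - 1) (by omega)
  rw [show n - 1 + 1 = n by omega, hnj] at hlast
  rcases hlast with h | h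
  · have hlt := hr _ _ h
    rcases Nat.eq_zero_or_pos (n - 1) with hz | hz
    · rw [hz, h0] at h
      exact hE h
    · refine (hconn (n - 1) hz (by omega)).2 ?_ ((hC _).2 ⟨hlt, fun he => ?_⟩)
      · rintro ⟨-, h'⟩
        rw [show n - 1 + 1 = n by omega, hnj] at h'
        exact lt_asymm hlt (hr _ _ h')
      · have := hf (n - 1) 0 (by omega) (by omega) (he.trans h0.symm)
        omega
  · have key : ∀ m, m < n → E (f (n - m)) (f (n - 1 - m)) ∧ r j < r (f (n - 1 - m)) := by
      intro m
      induction m with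
      | zero =>
        intro _
        simp only [Nat.sub_zero, hnj]
        exact ⟨h, hr _ _ h⟩
      | succ m ih =>
        intro hm
        obtain ⟨ih1, ih2⟩ := ih (by omega)
        have hc := (hconn (n - 1 - m) (by omega) (by omega)).1
        have ha := hadj (n - 1 - (m + 1)) (by omega)
        rw [show n - 1 - (m + 1) + 1 = n - 1 - m by omega] at ha
        have he := ha.resolve_left (by
          intro h'
          have hcol := hc ⟨by rwa [show n - 1 - m - 1 = n - 1 - (m + 1) by omega],
            by rwa [show n - 1 - m + 1 = n - m by omega]⟩
          rcases hcol with hcol | ⟨d, hd, hcol⟩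
          · have := ((hC _).1 hcol).1
            omega
          · have h1 := ((hC _).1 hd).1
            have h2 := Desc.rank_le hr hcol
            omega)
        rw [show n - (m + 1) = n - 1 - m by omega]
        exact ⟨he, ih2.trans (hr _ _ he)⟩
    have := (key (n - 1) (by omega)).2
    rw [show n - 1 - (n - 1) = 0 by omega, h0] at this
    omega

/-- **Meek's conjecture, proved by Chickering.** Let `G` and `H` be DAGs on `Fin p`
such that `H` is an independence map of `G`, i.e. `I(H) ⊆ I(G)`. Then there is a
finite sequence of DAGs `G = G₀, G₁, …, G_M = H` in which each `G_{t+1}` is obtained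
from `G_t` either by adding a single directed edge or by reversing a single covered
edge of `G_t`. -/
theorem meek_conjecture {p : ℕ} (G H : Fin p → Fin p → Prop)
    (hG : Acyclic G) (hH : Acyclic H) (himap : Indep H ⊆ Indep G) :
    Relation.ReflTransGen MeekStep G H := by
  classical
  obtain ⟨r, hinj, hr⟩ := hH.exists_rank
  obtain ⟨n, hn⟩ := (Set.finite_range r).bddAbove
  have hlt : ∀ v, r v < n + 1 := fun v => Nat.lt_succ_of_le (hn ⟨v, rfl⟩)
  refine Invariant.reflTransGen_meekStep (n := n + 1) hH hinj ⟨hG, ?_, ?_, ?_⟩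
  · exact fun a b hb => absurd (hlt b) (not_lt.2 hb)
  · exact fun a b ha => absurd (hlt a) (not_lt.2 ha)
  · intro i j hij _ hconn
    by_contra hnot
    have hne : i ≠ j := fun h => hij.ne (congrArg r h)
    let C : Finset (Fin p) := Finset.univ.filter fun v => r v < r j ∧ v ≠ i
    have hC : ∀ v, v ∈ C ↔ r v < r j ∧ v ≠ i := by simp [C]
    have hiC : i ∉ C := fun h => ((hC i).1 h).2 rfl
    have hjC : j ∉ C := fun h => lt_irrefl _ ((hC j).1 h).1
    have hsep : (i, j, C) ∈ Indep G :=
      himap ⟨hne, hiC, hjC, dsep_of_rank hr hij hnot hC⟩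
    obtain ⟨m, f, hf⟩ := exists_dwalk_of_moralConn hG hiC (fun t ht => by
      rcases (show r t ≤ r j from ht).eq_or_lt with h | h
      · exact Or.inr (Or.inr (hinj h))
      · by_cases hti : t = i
        · exact Or.inr (Or.inl hti)
        · exact Or.inl ((hC t).2 ⟨h, hti⟩))
      (fun c hc => ((hC c).1 hc).1.le) hconn
    exact hf.not_dsep hG hne hsep.2.2.2

end CausalDiscovery
end
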